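/- arXiv:2403.16323 — 2 statements merged into one kernel-verified Lean document; each statement's English description precedes it below -/
import Mathlib

section
/- For all g, h ∈ ℤ[1/p]^d, the operator norm on E of Σ_{j=1}^d g_j γ_j + (𝔽(h) − 𝔽(h − g)) γ_{d+1} is at most 𝕃(g) = √(Σ_{j=1}^d g_j² + 𝔽(g)²). -/
open scoped BigOperators

/-- The additive subgroup `ℤ[1/p]^d` of `ℚ^d`, consisting of vectors `z` such that
`p^n z ∈ ℤ^d` for some `n ∈ ℕ`. -/
def solGroup (p d : ℕ) : AddSubgroup (Fin d → ℚ) where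
  carrier := {z | ∃ n : ℕ, ∀ j, ∃ m : ℤ, (p : ℚ) ^ n * z j = m}
  zero_mem' := ⟨0, fun j => ⟨0, by simp⟩⟩
  add_mem' := by
    rintro x y ⟨a, hx⟩ ⟨b, hy⟩
    refine ⟨a + b, fun j => ?_⟩
    obtain ⟨m₁, h₁⟩ := hx j
    obtain ⟨m₂, h₂⟩ := hy j
    refine ⟨(p : ℤ) ^ b * m₁ + (p : ℤ) ^ a * m₂, ?_⟩
    have : (p : ℚ) ^ (a + b) * (x + y) j
        = (p : ℚ) ^ b * ((p : ℚ) ^ a * x j) + (p : ℚ) ^ a * ((p : ℚ) ^ b * y j) := by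
      simp [Pi.add_apply]; ring
    rw [this, h₁, h₂]
    push_cast
    ring
  neg_mem' := by
    rintro x ⟨a, hx⟩
    refine ⟨a, fun j => ?_⟩
    obtain ⟨m, h⟩ := hx j
    refine ⟨-m, ?_⟩
    have : (p : ℚ) ^ a * (-x) j = -((p : ℚ) ^ a * x j) := by simp
    rw [this, h]
    push_cast
    ring

/-- The subgroup `G_n = (p^{-n} ℤ)^d`, as a predicate on `ℚ^d`. -/
def memGn (p d n : ℕ) (z : Fin d → ℚ) : Prop := ∀ j, ∃ m : ℤ, (p : ℚ) ^ n * z j = m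

/-- `min {n ∈ ℕ : p^n z ∈ ℤ^d}`. -/
noncomputable def padMin (p d : ℕ) (z : Fin d → ℚ) : ℕ :=
  sInf {n : ℕ | ∀ j, ∃ m : ℤ, (p : ℚ) ^ n * z j = m}

/-- The function `𝔽(z) = p^{min {n ∈ ℕ : p^n z ∈ ℤ^d}}`. -/
noncomputable def Fp (p d : ℕ) (z : Fin d → ℚ) : ℝ := (p : ℝ) ^ padMin p d z

/-- The length function `𝕃(z) = √(Σ_j z_j² + 𝔽(z)²)`. -/
noncomputable def Lp (p d : ℕ) (z : Fin d → ℚ) : ℝ :=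
  Real.sqrt ((∑ j, ((z j : ℝ)) ^ 2) + (Fp p d z) ^ 2)

/-- The square of a real linear combination of pairwise anticommuting involutions. -/
theorem sum_smul_mul_self_of_anticommute {ι A : Type*} [Fintype ι] [Ring A] [Algebra ℂ A]
    (γ : ι → A) (hunit : ∀ i, γ i * γ i = 1)
    (hanti : ∀ i j, i ≠ j → γ i * γ j = -(γ j * γ i)) (c : ι → ℝ) :
    (∑ i, (c i : ℂ) • γ i) * (∑ i, (c i : ℂ) • γ i) = ((∑ i, c i ^ 2 : ℝ) : ℂ) • (1 : A) := by
  classical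
  have hdouble : (∑ i, (c i : ℂ) • γ i) * (∑ i, (c i : ℂ) • γ i)
      + (∑ i, (c i : ℂ) • γ i) * (∑ i, (c i : ℂ) • γ i)
      = (2 : ℂ) • (((∑ i, c i ^ 2 : ℝ) : ℂ) • (1 : A)) := by
    rw [Finset.sum_mul_sum]
    nth_rewrite 2 [Finset.sum_comm]
    rw [← Finset.sum_add_distrib]
    push_cast
    rw [Finset.sum_smul, Finset.smul_sum]
    refine Finset.sum_congr rfl fun i _ => ?_
    rw [← Finset.sum_add_distrib, Finset.sum_eq_single i]
    · rw [smul_mul_smul_comm, hunit, ← two_smul ℂ, sq]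
    · intro j _ hj
      rw [smul_mul_smul_comm, smul_mul_smul_comm, hanti i j hj.symm, smul_neg,
        mul_comm (c i : ℂ), neg_add_cancel]
    · simp
  rw [← two_smul ℂ] at hdouble
  exact smul_right_injective A (two_ne_zero : (2 : ℂ) ≠ 0) hdouble

/-- A real linear combination of pairwise anticommuting self-adjoint unitaries in a C⋆-algebra
has norm at most the Euclidean norm of its coefficients. -/
theorem norm_sum_smul_le_sqrt_of_anticommute {ι A : Type*} [Fintype ι] [NormedRing A]
    [StarRing A] [CStarRing A] [NormedAlgebra ℂ A] [StarModule ℂ A]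
    (γ : ι → A) (hsa : ∀ i, IsSelfAdjoint (γ i)) (hunit : ∀ i, γ i * γ i = 1)
    (hanti : ∀ i j, i ≠ j → γ i * γ j = -(γ j * γ i)) (c : ι → ℝ) :
    ‖∑ i, (c i : ℂ) • γ i‖ ≤ Real.sqrt (∑ i, c i ^ 2) := by
  have hsum : star (∑ i, (c i : ℂ) • γ i) = ∑ i, (c i : ℂ) • γ i := by
    simp [star_sum, star_smul, (hsa _).star_eq]
  have hone : ‖(1 : A)‖ ≤ 1 := by
    nontriviality A
    exact CStarRing.norm_one.le
  have hnonneg : 0 ≤ ∑ i, c i ^ 2 := Finset.sum_nonneg fun i _ => sq_nonneg _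
  apply Real.le_sqrt_of_sq_le
  rw [sq, ← CStarRing.norm_star_mul_self, hsum, sum_smul_mul_self_of_anticommute γ hunit hanti,
    norm_smul, Complex.norm_real, Real.norm_of_nonneg hnonneg]
  exact mul_le_of_le_one_right hnonneg hone

theorem memGn.mono {p d m n : ℕ} (hmn : m ≤ n) {z : Fin d → ℚ} (hz : memGn p d m z) :
    memGn p d n z := by
  intro j
  obtain ⟨a, ha⟩ := hz j
  refine ⟨(p : ℤ) ^ (n - m) * a, ?_⟩
  push_cast
  rw [← ha, ← mul_assoc, ← pow_add, Nat.sub_add_cancel hmn]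

theorem memGn.add {p d n : ℕ} {x y : Fin d → ℚ} (hx : memGn p d n x) (hy : memGn p d n y) :
    memGn p d n (x + y) := by
  intro j
  obtain ⟨a, ha⟩ := hx j
  obtain ⟨b, hb⟩ := hy j
  exact ⟨a + b, by rw [Pi.add_apply, mul_add, ha, hb, Int.cast_add]⟩

theorem memGn.neg {p d n : ℕ} {x : Fin d → ℚ} (hx : memGn p d n x) : memGn p d n (-x) := by
  intro j
  obtain ⟨a, ha⟩ := hx j
  exact ⟨-a, by rw [Pi.neg_apply, mul_neg, ha, Int.cast_neg]⟩

theorem memGn.sub {p d n : ℕ} {x y : Fin d → ℚ} (hx : memGn p d n x) (hy : memGn p d n y) :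
    memGn p d n (x - y) :=
  sub_eq_add_neg x y ▸ hx.add hy.neg

theorem padMin_le_iff {p d n : ℕ} {z : Fin d → ℚ} (hz : z ∈ solGroup p d) :
    padMin p d z ≤ n ↔ memGn p d n z :=
  ⟨fun hn => memGn.mono hn (Nat.sInf_mem (s := {n | memGn p d n z}) hz),
    fun hn => Nat.sInf_le (s := {n | memGn p d n z}) hn⟩

theorem Fp_pos {p d : ℕ} (hp : 1 ≤ p) (z : Fin d → ℚ) : 0 < Fp p d z :=
  pow_pos (by exact_mod_cast hp) _

theorem abs_Fp_sub_le {p d : ℕ} (hp : 1 ≤ p) {g h : Fin d → ℚ} (hg : g ∈ solGroup p d)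
    (hh : h ∈ solGroup p d) : |Fp p d h - Fp p d (h - g)| ≤ Fp p d g := by
  have hhg : h - g ∈ solGroup p d := sub_mem hh hg
  have memSelf {z : Fin d → ℚ} (hz : z ∈ solGroup p d) : memGn p d (padMin p d z) z :=
    (padMin_le_iff hz).1 le_rfl
  have hle : padMin p d (h - g) ≤ max (padMin p d h) (padMin p d g) :=
    (padMin_le_iff hhg).2
      (((memSelf hh).mono (le_max_left _ _)).sub ((memSelf hg).mono (le_max_right _ _)))
  have hle' : padMin p d h ≤ max (padMin p d (h - g)) (padMin p d g) := by
    refine (padMin_le_iff hh).2 ?_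
    have := ((memSelf hhg).mono (le_max_left _ (padMin p d g))).add
      ((memSelf hg).mono (le_max_right (padMin p d (h - g)) _))
    rwa [sub_add_cancel] at this
  by_cases hlt : padMin p d g < padMin p d h
  · have heq : padMin p d (h - g) = padMin p d h := by omega
    rw [Fp, Fp, heq, sub_self, abs_zero]
    exact (Fp_pos hp g).le
  · have hp' : (1 : ℝ) ≤ p := by exact_mod_cast hp
    have h₁ : Fp p d h ≤ Fp p d g := pow_le_pow_right₀ hp' (by omega)
    have h₂ : Fp p d (h - g) ≤ Fp p d g := pow_le_pow_right₀ hp' (by omega)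
    rw [abs_le]
    constructor <;> linarith [Fp_pos hp h, Fp_pos hp (h - g)]

/-- For all `g, h ∈ ℤ[1/p]^d`, the operator norm on `E` of
`Σ_{j=1}^d g_j γ_j + (𝔽(h) − 𝔽(h − g)) γ_{d+1}` is at most
`𝕃(g) = √(Σ_j g_j² + 𝔽(g)²)`, where `γ_1, …, γ_{d+1}` are self-adjoint unitary
pairwise anticommuting operators on a nonzero finite-dimensional complex inner
product space `E`. -/
theorem commutator_block_norm_le (p d : ℕ) (hp : 2 ≤ p) (hd : 2 ≤ d)
    {E : Type*} [NormedAddCommGroup E] [InnerProductSpace ℂ E]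
    [FiniteDimensional ℂ E] [Nontrivial E]
    (γ : Fin (d + 1) → (E →L[ℂ] E))
    (hsa : ∀ i, IsSelfAdjoint (γ i))
    (hunit : ∀ i, γ i * γ i = 1)
    (hanti : ∀ i j, i ≠ j → γ i * γ j = -(γ j * γ i))
    (g h : Fin d → ℚ) (hg : g ∈ solGroup p d) (hh : h ∈ solGroup p d) :
    ‖(∑ j : Fin d, (((g j : ℝ)) : ℂ) • γ j.castSucc)
      + (((Fp p d h - Fp p d (h - g) : ℝ)) : ℂ) • γ (Fin.last d)‖ ≤ Lp p d g := by
  have hbound := norm_sum_smul_le_sqrt_of_anticommute γ hsa hunit hanti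
    (Fin.snoc (fun j => (g j : ℝ)) (Fp p d h - Fp p d (h - g)) : Fin (d + 1) → ℝ)
  simp only [Fin.sum_univ_castSucc, Fin.snoc_castSucc, Fin.snoc_last] at hbound
  refine hbound.trans (Real.sqrt_le_sqrt ?_)
  exact add_le_add_right
    (sq_le_sq.2 ((abs_Fp_sub_le (by omega) hg hh).trans (le_abs_self _))) _
end

section
/- The operator on ℓ²(ℤ[1/p]^d; E) defined by ξ ↦ (z ↦ (1 + 𝕃(z)²)^{−1} ξ(z)) is a well-defined bounded linear operator and is compact. (This expresses that the Dirac operator D, with |D| equal to multiplication by 𝕃, has compact resolvent.) -/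
open scoped BigOperators

open Filter Topology ENNReal

/-- A diagonal operator between `ℓ^p` direct sums is compact if its entries tend to zero in norm
along the cofinite filter and take values in locally compact spaces. -/
theorem lp.isCompactOperator_mapCLM {α 𝕜 : Type*} {E F : α → Type*} [NontriviallyNormedField 𝕜]
    [∀ i, NormedAddCommGroup (E i)] [∀ i, NormedSpace 𝕜 (E i)]
    [∀ i, NormedAddCommGroup (F i)] [∀ i, NormedSpace 𝕜 (F i)]
    [∀ i, LocallyCompactSpace (F i)] [∀ i, CompleteSpace (F i)]
    (p : ℝ≥0∞) [Fact (1 ≤ p)] (T : ∀ i, E i →L[𝕜] F i) {K : ℝ} (hK : 0 ≤ K)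
    (hTK : ∀ i, ‖T i‖ ≤ K) (hT : Tendsto (fun i => ‖T i‖) cofinite (𝓝 0)) :
    IsCompactOperator (lp.mapCLM p T hK hTK) := by
  classical
  let S : Finset α → (lp E p →L[𝕜] lp F p) := fun s =>
    ∑ i ∈ s, (lp.singleContinuousLinearMap 𝕜 F p i).comp ((T i).comp (lp.evalCLM 𝕜 E p i))
  have hS (s : Finset α) (x : lp E p) (i : α) : S s x i = if i ∈ s then T i (x i) else 0 := by
    simp only [S, sum_apply, ContinuousLinearMap.comp_apply,
      lp.singleContinuousLinearMap_apply, lp.coeFn_sum, Finset.sum_apply, lp.single_apply]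
    rw [Finset.sum_pi_single]
    rfl
  have hcpt (s : Finset α) : IsCompactOperator (S s) := by
    refine (compactOperator (RingHom.id 𝕜) (lp E p) (lp F p)).sum_mem fun i _ => ?_
    exact (isCompactOperator_of_locallyCompactSpace_dom
      ((T i).comp (lp.evalCLM 𝕜 E p i))).clm_comp (lp.singleContinuousLinearMap 𝕜 F p i)
  refine isCompactOperator_of_tendsto (l := atTop) (F := S) ?_ (.of_forall hcpt)
  rw [Metric.tendsto_atTop]
  intro ε hε
  have hfin : {i | ¬ ‖T i‖ < ε / 2}.Finite := hT.eventually_lt_const (half_pos hε)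
  refine ⟨hfin.toFinset, fun s hs => ?_⟩
  have hb (i : α) : ‖if i ∈ s then 0 else T i‖ ≤ ε / 2 := by
    split_ifs with hi
    · simpa using (half_pos hε).le
    · by_contra! h
      exact hi (hs (by simpa using h.le))
  have heq : lp.mapCLM p T hK hTK - S s
      = lp.mapCLM p (fun i => if i ∈ s then 0 else T i) (half_pos hε).le hb := by
    ext x i
    have h := hS s x i
    simp only [sub_apply, lp.coeFn_sub, Pi.sub_apply, h,
      lp.mapCLM_apply_coe]
    split_ifs <;> simp
  rw [dist_comm, dist_eq_norm, heq]
  exact (lp.norm_mapCLM_le p _ _ hb).trans_lt (half_lt_self hε)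

theorem padMin_spec {p d : ℕ} (z : solGroup p d) :
    ∀ j, ∃ m : ℤ, (p : ℚ) ^ padMin p d z * (z : Fin d → ℚ) j = m :=
  Nat.sInf_mem z.2

/-- The length function `Lp` is proper: its sublevel sets are finite. -/
theorem finite_setOf_Lp_le {p : ℕ} (hp : 2 ≤ p) (d : ℕ) (R : ℝ) :
    {z : solGroup p d | Lp p d z ≤ R}.Finite := by
  obtain ⟨N, hN⟩ := pow_unbounded_of_one_lt R (by exact_mod_cast hp : (1 : ℝ) < p)
  have hp0 : (0 : ℚ) < p := by exact_mod_cast (by lia : 0 < p)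
  obtain ⟨M, hM⟩ := exists_nat_ge ((p : ℝ) ^ N * R)
  let A : Set ℚ := (fun m : ℤ => (m : ℚ) / (p : ℚ) ^ N) '' Set.Icc (-(M : ℤ)) M
  have hA : A.Finite := (Set.finite_Icc _ _).image _
  have hpi : {z : Fin d → ℚ | ∀ j, z j ∈ A}.Finite := Set.Finite.pi' fun _ => hA
  refine (hpi.preimage Subtype.val_injective.injOn).subset fun z hz j => ?_
  have hF : Fp p d z ≤ R := by
    refine le_trans (Real.le_sqrt_of_sq_le ?_) hz
    exact le_add_of_nonneg_left (Finset.sum_nonneg fun _ _ => sq_nonneg _)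
  have hzj : |(((z : Fin d → ℚ) j : ℚ) : ℝ)| ≤ R := by
    refine le_trans (Real.le_sqrt_of_sq_le ?_) hz
    rw [sq_abs]
    exact le_add_of_le_of_nonneg (Finset.single_le_sum
      (f := fun j => (((z : Fin d → ℚ) j : ℚ) : ℝ) ^ 2) (fun _ _ => sq_nonneg _)
      (Finset.mem_univ j)) (sq_nonneg _)
  have hn : padMin p d z ≤ N :=
    (pow_lt_pow_iff_right₀ (by exact_mod_cast hp : (1 : ℝ) < p)).1 (hF.trans_lt hN) |>.le
  obtain ⟨m, hm⟩ := padMin_spec z j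
  have hk : (p : ℚ) ^ N * (z : Fin d → ℚ) j = ((p : ℤ) ^ (N - padMin p d z) * m : ℤ) := by
    push_cast
    rw [← hm, ← mul_assoc, ← pow_add, Nat.sub_add_cancel hn]
  refine ⟨(p : ℤ) ^ (N - padMin p d z) * m, ?_, ?_⟩
  · have h : |(((p : ℤ) ^ (N - padMin p d z) * m : ℤ) : ℝ)| ≤ M := by
      have hk' : (p : ℝ) ^ N * (((z : Fin d → ℚ) j : ℚ) : ℝ)
          = ((p : ℤ) ^ (N - padMin p d z) * m : ℤ) := by
        exact_mod_cast congrArg (Rat.cast : ℚ → ℝ) hk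
      rw [← hk', abs_mul, abs_of_nonneg (by positivity : (0 : ℝ) ≤ (p : ℝ) ^ N)]
      exact (mul_le_mul_of_nonneg_left hzj (by positivity)).trans hM
    rw [Set.mem_Icc, ← abs_le]
    exact_mod_cast h
  · change ((((p : ℤ) ^ (N - padMin p d z) * m : ℤ) : ℚ)) / (p : ℚ) ^ N = _
    rw [← hk, mul_div_cancel_left₀ _ (by positivity)]

theorem tendsto_Lp_cofinite_atTop {p : ℕ} (hp : 2 ≤ p) (d : ℕ) :
    Tendsto (fun z : solGroup p d => Lp p d z) cofinite atTop := by
  refine tendsto_atTop.2 fun R => ?_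
  refine (finite_setOf_Lp_le hp d R).subset fun z hz => ?_
  exact le_of_not_ge (show ¬ R ≤ Lp p d z from hz)

/-- The operator on `ℓ²(ℤ[1/p]^d; E)` defined by
`ξ ↦ (z ↦ (1 + 𝕃(z)²)⁻¹ ξ(z))` is a well-defined bounded linear operator and is compact.
(The Dirac operator `D`, with `|D|` equal to multiplication by `𝕃`, has compact
resolvent.) -/
theorem resolvent_compact (p d : ℕ) (hp : 2 ≤ p) (hd : 2 ≤ d)
    {E : Type*} [NormedAddCommGroup E] [InnerProductSpace ℂ E]
    [FiniteDimensional ℂ E] [Nontrivial E] :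
    ∃ T : lp (fun _ : solGroup p d => E) 2 →L[ℂ] lp (fun _ : solGroup p d => E) 2,
      (∀ ξ : lp (fun _ : solGroup p d => E) 2, ∀ z : solGroup p d,
        (T ξ : ∀ _ : solGroup p d, E) z
          = ((1 + Lp p d (z : Fin d → ℚ) ^ 2)⁻¹ : ℝ) • (ξ : ∀ _ : solGroup p d, E) z) ∧
      IsCompactOperator T := by
  let f : solGroup p d → ℝ := fun z => (1 + Lp p d z ^ 2)⁻¹
  have hf0 (z : solGroup p d) : 0 ≤ f z := by positivity
  have hf1 (z : solGroup p d) : f z ≤ 1 :=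
    inv_le_one_of_one_le₀ (le_add_of_nonneg_right (sq_nonneg _))
  have hf : Tendsto f cofinite (𝓝 0) := by
    refine tendsto_inv_atTop_zero.comp (tendsto_atTop_add_const_left _ 1 ?_)
    exact (tendsto_pow_atTop two_ne_zero).comp (tendsto_Lp_cofinite_atTop hp d)
  let A : solGroup p d → E →L[ℂ] E := fun z => f z • ContinuousLinearMap.id ℂ E
  have hA (z : solGroup p d) : ‖A z‖ = f z := by
    simp [A, norm_smul, abs_of_nonneg (hf0 z)]
  have : ProperSpace E := FiniteDimensional.proper ℂ E
  have : CompleteSpace E := FiniteDimensional.complete ℂ E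
  refine ⟨lp.mapCLM 2 A zero_le_one fun z => (hA z).trans_le (hf1 z), fun ξ z => rfl, ?_⟩
  exact lp.isCompactOperator_mapCLM 2 A _ _ (by simpa only [hA] using hf)
end
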